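/- arXiv:1310.3306 — 3 statements merged into one kernel-verified Lean document; each statement's English description precedes it below -/
import Mathlib

section
/- Let R be a commutative ring, G a finite group acting on a type I, and (M_i)_{i∈I} a family of R-modules. Suppose G acts R-linearly on the direct sum M = ⊕_{i∈I} M_i in such a way that each g ∈ G carries the summand M_i into the summand M_{g·i}. Fix a set J ⊆ I of representatives for the G-orbits on I. Then the R-submodule M^G of G-fixed points of M is isomorphic, as an R-module, to ⊕_{j∈J} (M_j)^{G_j}, where G_j is the stabilizer of j in G and (M_j)^{G_j} is the set of elements of M_j fixed by the induced action of G_j. Moreover, an isomorphism is given by sending a fixed vector to its tuple of components at the indices in J, with inverse sending (X_j)_{j∈J} to Σ_{j∈J} Σ_{gG_j ∈ G/G_j} g·X_j. -/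
open DirectSum

section CosetSum

variable {R : Type*} [CommRing R] {G : Type*} [Group G] {N : Type*} [AddCommGroup N]
  [Module R N] {ρ : G →* (N ≃ₗ[R] N)}

theorem apply_eq_of_mk_eq {H : Subgroup G} {m : N} (hm : ∀ g ∈ H, ρ g m = m)
    {a b : G} (hab : (a : G ⧸ H) = b) : ρ a m = ρ b m := by
  have := hm _ (QuotientGroup.eq.1 hab)
  conv_lhs => rw [← this, ← LinearEquiv.mul_apply, ← map_mul, mul_inv_cancel_left]

variable [Finite G]

/-- The sum of the translates of a vector by coset representatives of `H`. -/
noncomputable def cosetSum (ρ : G →* (N ≃ₗ[R] N)) (H : Subgroup G) :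
    N →ₗ[R] N :=
  letI := Fintype.ofFinite (G ⧸ H)
  ∑ c : G ⧸ H, (ρ c.out).toLinearMap

theorem cosetSum_apply (H : Subgroup G) (m : N) :
    cosetSum ρ H m = ∑ᶠ c : G ⧸ H, ρ c.out m := by
  let := Fintype.ofFinite (G ⧸ H)
  simp [cosetSum, finsum_eq_sum_of_fintype]

theorem apply_cosetSum {H : Subgroup G} {m : N} (hm : ∀ g ∈ H, ρ g m = m) (g : G) :
    ρ g (cosetSum ρ H m) = cosetSum ρ H m := by
  rw [cosetSum_apply]
  refine ((ρ g).toAddEquiv.toAddMonoidHom.map_finsum (Set.toFinite _)).trans ?_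
  refine finsum_eq_of_bijective (g • ·) (MulAction.bijective g) fun c => ?_
  change ρ g (ρ c.out m) = _
  rw [← LinearEquiv.mul_apply, ← map_mul]
  apply apply_eq_of_mk_eq hm
  rw [QuotientGroup.out_eq', ← smul_eq_mul, ← MulAction.Quotient.smul_coe,
    QuotientGroup.out_eq']

end CosetSum

section PermutedSummands

variable {R : Type*} [CommRing R] {G : Type*} [Group G] {I : Type*} [DecidableEq I]
  [MulAction G I] {M : I → Type*} [∀ i, AddCommGroup (M i)] [∀ i, Module R (M i)]
  {ρ : G →* ((⨁ i, M i) ≃ₗ[R] (⨁ i, M i))}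

/-- `ρ` carries each summand `M i` into `M (g • i)`. -/
def PermutesSummands (ρ : G →* ((⨁ i, M i) ≃ₗ[R] (⨁ i, M i))) : Prop :=
  ∀ (g : G) (i : I) (x : M i),
    ρ g (DirectSum.lof R I M i x) ∈ LinearMap.range (DirectSum.lof R I M (g • i))

theorem PermutesSummands.apply_lof_of_ne (h : PermutesSummands ρ) {g : G} {i k : I}
    (hk : g • i ≠ k) (x : M i) : ρ g (DirectSum.lof R I M i x) k = 0 := by
  obtain ⟨y, hy⟩ := h g i x
  rw [← hy, DirectSum.lof_eq_of, DirectSum.of_eq_of_ne _ _ _ hk.symm]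

theorem PermutesSummands.apply_lof_eq (h : PermutesSummands ρ) {g : G} {i k : I}
    (hk : g • i = k) (x : M i) :
    ρ g (DirectSum.lof R I M i x) =
      DirectSum.lof R I M k (ρ g (DirectSum.lof R I M i x) k) := by
  subst hk
  obtain ⟨y, hy⟩ := h g i x
  rw [← hy, DirectSum.lof_apply]

theorem PermutesSummands.apply_component (h : PermutesSummands ρ) {g : G} {i k : I}
    (hk : g • i = k) (m : ⨁ i, M i) :
    ρ g m k = ρ g (DirectSum.lof R I M i (m i)) k := by
  induction m using DirectSum.induction_on with
  | zero => simp
  | of a x =>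
    rw [← DirectSum.lof_eq_of R]
    by_cases ha : a = i
    · subst ha
      rw [DirectSum.lof_apply]
    · have hne : g • a ≠ k := fun hc => ha (MulAction.injective g (hc.trans hk.symm))
      have hx : DirectSum.lof R I M a x i = 0 := DirectSum.of_eq_of_ne _ _ _ (Ne.symm ha)
      rw [h.apply_lof_of_ne hne, hx, map_zero, map_zero, DirectSum.zero_apply]
  | add x y hx hy => simp only [map_add, DirectSum.add_apply, hx, hy]

theorem PermutesSummands.apply_lof_component_of_fixed (h : PermutesSummands ρ)
    {m : ⨁ i, M i} (hm : ∀ g, ρ g m = m) {g : G} {i k : I} (hk : g • i = k) :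
    ρ g (DirectSum.lof R I M i (m i)) = DirectSum.lof R I M k (m k) := by
  rw [h.apply_lof_eq hk, ← h.apply_component hk, hm]

theorem PermutesSummands.eq_of_fixed (h : PermutesSummands ρ) {J : Set I}
    (hJ : ∀ i : I, ∃ j ∈ J, j ∈ MulAction.orbit G i) {m n : ⨁ i, M i}
    (hm : ∀ g, ρ g m = m) (hn : ∀ g, ρ g n = n) (hmn : ∀ j ∈ J, m j = n j) : m = n := by
  refine DirectSum.ext_component R fun i => ?_
  obtain ⟨j, hj, hji⟩ := hJ i
  obtain ⟨g, rfl⟩ := MulAction.mem_orbit_symm.1 hji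
  change m (g • j) = n (g • j)
  apply DirectSum.of_injective (β := M) (g • j)
  simp only [← DirectSum.lof_eq_of R]
  rw [← h.apply_lof_component_of_fixed hm rfl,
    ← h.apply_lof_component_of_fixed hn rfl, hmn j hj]

variable [Finite G]

theorem PermutesSummands.cosetSum_lof_of_notMem_orbit (h : PermutesSummands ρ) {j k : I}
    (hk : k ∉ MulAction.orbit G j) (H : Subgroup G) (x : M j) :
    cosetSum ρ H (DirectSum.lof R I M j x) k = 0 := by
  let := Fintype.ofFinite (G ⧸ H)
  rw [cosetSum_apply, finsum_eq_sum_of_fintype, DirectSum.sum_apply]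
  exact Finset.sum_eq_zero fun c _ => h.apply_lof_of_ne (fun hc => hk ⟨_, hc⟩) x

theorem PermutesSummands.cosetSum_lof_self (h : PermutesSummands ρ) {j : I} {x : M j}
    (hx : ∀ g ∈ MulAction.stabilizer G j,
      ρ g (DirectSum.lof R I M j x) = DirectSum.lof R I M j x) :
    cosetSum ρ (MulAction.stabilizer G j) (DirectSum.lof R I M j x) j = x := by
  let := Fintype.ofFinite (G ⧸ MulAction.stabilizer G j)
  rw [cosetSum_apply, finsum_eq_sum_of_fintype, DirectSum.sum_apply,
    Finset.sum_eq_single ((1 : G) : G ⧸ MulAction.stabilizer G j)]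
  · rw [apply_eq_of_mk_eq hx (QuotientGroup.out_eq' _), map_one, LinearEquiv.coe_one, id,
      DirectSum.lof_apply]
  · refine fun c _ hc => h.apply_lof_of_ne (fun hcj => hc ?_) x
    rw [← QuotientGroup.out_eq' c, QuotientGroup.eq, mul_one]
    exact inv_mem (MulAction.mem_stabilizer_iff.2 hcj)
  · simp

end PermutedSummands

/-- Galois-descent decomposition of fixed points of a finite group acting on a direct sum,
permuting the summands: if each `g ∈ G` carries the summand `M i` into `M (g • i)` and
`J` is a set of representatives for the `G`-orbits on `I`, then the fixed-point module
`M^G` is isomorphic to `⊕_{j ∈ J} (M j)^{G_j}`, via the map sending a fixed vector to its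
components at the indices in `J`; the inverse sends `(X_j)` to `Σ_j Σ_{gG_j ∈ G/G_j} g•X_j`. -/
theorem fixed_points_directSum_iso
    {R : Type*} [CommRing R] {G : Type*} [Group G] [Finite G]
    {I : Type*} [DecidableEq I] [MulAction G I]
    (M : I → Type*) [∀ i, AddCommGroup (M i)] [∀ i, Module R (M i)]
    (ρ : G →* ((⨁ i, M i) ≃ₗ[R] (⨁ i, M i)))
    (hρ : ∀ (g : G) (i : I) (x : M i),
      ρ g (DirectSum.lof R I M i x) ∈ LinearMap.range (DirectSum.lof R I M (g • i)))
    (J : Set I)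
    (hJ : ∀ i : I, ∃! j : I, j ∈ J ∧ j ∈ MulAction.orbit G i)
    (F : Submodule R (⨁ i, M i))
    (hF : ∀ m, m ∈ F ↔ ∀ g : G, ρ g m = m)
    (Fj : ∀ j : I, Submodule R (M j))
    (hFj : ∀ (j : I) (x : M j), x ∈ Fj j ↔ ∀ g ∈ MulAction.stabilizer G j,
      ρ g (DirectSum.lof R I M j x) = DirectSum.lof R I M j x) :
    ∃ e : F ≃ₗ[R] (⨁ j : J, Fj j),
      (∀ (m : F) (j : J), ((e m j : M j) : M (j : I)) = (m : ⨁ i, M i) (j : I)) ∧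
      (∀ (j : I) (hj : j ∈ J) (x : M j) (hx : x ∈ Fj j)
        (s : G ⧸ MulAction.stabilizer G j → G)
        (hs : ∀ c, QuotientGroup.mk (s c) = c),
        ((e.symm (DirectSum.lof R J (fun j : J => Fj j) ⟨j, hj⟩ ⟨x, hx⟩) : ⨁ i, M i)) =
          ∑ᶠ c : G ⧸ MulAction.stabilizer G j, ρ (s c) (DirectSum.lof R I M j x)) := by
  have h : PermutesSummands ρ := hρ
  let φ (j : I) : Fj j →ₗ[R] F :=
    LinearMap.codRestrict F
      (cosetSum ρ (MulAction.stabilizer G j) ∘ₗ DirectSum.lof R I M j ∘ₗ (Fj j).subtype)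
      fun x => (hF _).2 (apply_cosetSum ((hFj j x).1 x.2))
  let Φ : (⨁ j : J, Fj j) →ₗ[R] F := DirectSum.toModule R J F fun j => φ j
  have hΦ (X : ⨁ j : J, Fj j) (j : J) : (Φ X : ⨁ i, M i) j = X j := by
    induction X using DirectSum.induction_on with
    | zero => simp
    | of k x =>
      rw [← DirectSum.lof_eq_of R]
      simp only [Φ, DirectSum.toModule_lof]
      change cosetSum ρ _ (DirectSum.lof R I M k x) j = _
      by_cases hjk : k = j
      · subst hjk
        rw [h.cosetSum_lof_self ((hFj k x).1 x.2), DirectSum.lof_apply]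
      · rw [h.cosetSum_lof_of_notMem_orbit, DirectSum.lof_eq_of,
          DirectSum.of_eq_of_ne _ _ _ (Ne.symm hjk), Submodule.coe_zero]
        exact fun hc => hjk (Subtype.ext
          ((hJ k).unique ⟨k.2, MulAction.mem_orbit_self _⟩ ⟨j.2, hc⟩))
    | add x y hx hy =>
      simp only [map_add, Submodule.coe_add, DirectSum.add_apply, hx, hy]
  have hbij : Function.Bijective Φ := by
    constructor
    · intro X Y hXY
      refine DirectSum.ext_component R fun j => Subtype.ext ?_
      change (X j : M j) = Y j
      rw [← hΦ, hXY, hΦ]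
    · intro m
      have hm := (hF m).1 m.2
      let s : Finset J :=
        ((DFinsupp.finite_support (m : ⨁ i, M i)).preimage
          Subtype.val_injective.injOn).toFinset
      let X : ⨁ j : J, Fj j := DirectSum.mk (fun j : J => Fj j) s fun j =>
        ⟨(m : ⨁ i, M i) j, (hFj _ _).2 fun g hg => h.apply_lof_component_of_fixed hm hg⟩
      refine ⟨X, Subtype.ext (h.eq_of_fixed (fun i => (hJ i).exists) ((hF _).1 (Φ X).2) hm
        fun j hj => (hΦ X ⟨j, hj⟩).trans ?_)⟩
      by_cases hs : (⟨j, hj⟩ : J) ∈ s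
      · rw [DirectSum.mk_apply_of_mem hs]
      · rw [DirectSum.mk_apply_of_notMem hs, Submodule.coe_zero]
        simpa [s, eq_comm] using hs
  refine ⟨(LinearEquiv.ofBijective Φ hbij).symm, fun m j => ?_, fun j hj x hx s hs => ?_⟩
  · rw [← hΦ, ← LinearEquiv.ofBijective_apply Φ (hf := hbij), LinearEquiv.apply_symm_apply]
  · rw [LinearEquiv.symm_symm, LinearEquiv.ofBijective_apply]
    simp only [Φ, DirectSum.toModule_lof]
    change cosetSum ρ _ (DirectSum.lof R I M j x) = _
    rw [cosetSum_apply]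
    exact finsum_congr fun c => apply_eq_of_mk_eq ((hFj j x).1 hx)
      ((QuotientGroup.out_eq' c).trans (hs c).symm)
end

section
/- Let G be a group and A, U, H subgroups of G such that A normalizes U (so that A·U is a subgroup). Let C ⊆ G be a subset satisfying A·C·H = C, and suppose that for every c ∈ C one has U ∩ (C·c⁻¹) ⊆ A·(cHc⁻¹). Then the natural map from the set of double cosets A\C/H to the set of double cosets (A·U)\(U·C)/H, sending A·c·H to (A·U)·c·H, is a bijection. -/
open scoped Pointwise

open DoubleCoset in
/-- Under the rigidity hypothesis, an `(A ⊔ U, H)`-double coset contains at most one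
`(A, H)`-double coset lying in `C`. -/
theorem mem_doubleCoset_of_mem_doubleCoset_sup
    {G : Type*} [Group G] {A U H : Subgroup G} {C : Set G}
    (hnorm : A ≤ Subgroup.normalizer (U : Set G))
    (hC : (A : Set G) * C * (H : Set G) = C)
    (hrigid : ∀ c ∈ C,
      (U : Set G) ∩ (C * {c⁻¹}) ⊆ (A : Set G) * ((fun x => c * x * c⁻¹) '' (H : Set G)))
    {c d : G} (hc : c ∈ C) (hd : d ∈ C)
    (h : d ∈ doubleCoset c ((A ⊔ U : Subgroup G) : Set G) H) :
    d ∈ doubleCoset c (A : Set G) H := by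
  rw [mem_doubleCoset, Subgroup.coe_mul_of_left_le_normalizer_right A U hnorm] at h
  obtain ⟨_, ⟨a, ha, u, hu, rfl⟩, k, hk, rfl⟩ := h
  have huc : u * c ∈ C := by
    rw [← hC]
    exact ⟨_, ⟨a⁻¹, A.inv_mem ha, _, hd, rfl⟩, k⁻¹, H.inv_mem hk, by group⟩
  obtain ⟨b, hb, _, ⟨l, hl, rfl⟩, hbl⟩ :=
    hrigid c hc ⟨hu, _, huc, c⁻¹, rfl, mul_inv_cancel_right u c⟩
  refine mem_doubleCoset.2 ⟨a * b, A.mul_mem ha hb, l * k, H.mul_mem hl hk, ?_⟩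
  dsimp only at hbl ⊢
  rw [← hbl]
  group

/-- Let `A`, `U`, `H` be subgroups of `G` with `A` normalizing `U`, and let `C ⊆ G`
satisfy `A·C·H = C`.  If for every `c ∈ C` one has `U ∩ (C·c⁻¹) ⊆ A·(cHc⁻¹)`, then the
natural map `A\C/H → (AU)\(UC)/H`, sending the double coset `A·c·H` to `(A·U)·c·H`,
is a bijection. -/
theorem doset_projection_bijective
    {G : Type*} [Group G] (A U H : Subgroup G) (C : Set G)
    (hnorm : ∀ a ∈ A, ∀ u ∈ U, a * u * a⁻¹ ∈ U)
    (hC : (A : Set G) * C * (H : Set G) = C)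
    (hrigid : ∀ c ∈ C,
      (U : Set G) ∩ (C * {c⁻¹}) ⊆ (A : Set G) * ((fun x => c * x * c⁻¹) '' (H : Set G))) :
    ∃ e : {S : Set G // ∃ c ∈ C, S = (A : Set G) * {c} * (H : Set G)} ≃
          {S : Set G // ∃ x ∈ (U : Set G) * C,
            S = ((A : Set G) * (U : Set G)) * {x} * (H : Set G)},
      ∀ (c : G) (hc : c ∈ C),
        (e ⟨(A : Set G) * {c} * (H : Set G), ⟨c, hc, rfl⟩⟩ : Set G) =
          ((A : Set G) * (U : Set G)) * {c} * (H : Set G) := by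
  have hA : A ≤ Subgroup.normalizer (U : Set G) := Subgroup.le_normalizer_iff.2 hnorm
  have hAU := Subgroup.coe_mul_of_left_le_normalizer_right A U hA
  have hUA : (A : Set G) * U * A = A * U := by
    rw [mul_assoc, ← Subgroup.set_mul_normalizer_comm (A : Set G) U hA, ← mul_assoc,
      coe_mul_coe]
  have hproj (c : G) : (A : Set G) * U * (A * {c} * H) = A * U * {c} * H := by
    rw [← mul_assoc, ← mul_assoc, hUA]
  let f : {S : Set G // ∃ c ∈ C, S = (A : Set G) * {c} * (H : Set G)} →
      {S : Set G // ∃ x ∈ (U : Set G) * C,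
        S = ((A : Set G) * (U : Set G)) * {x} * (H : Set G)} := fun S =>
    ⟨(A : Set G) * U * S.1, by
      obtain ⟨_, c, hc, rfl⟩ := S
      exact ⟨c, ⟨1, U.one_mem, c, hc, one_mul c⟩, hproj c⟩⟩
  have hf : Function.Bijective f := by
    constructor
    · rintro ⟨_, c, hc, rfl⟩ ⟨_, d, hd, rfl⟩ hcd
      have hcd : (A : Set G) * U * (A * {c} * H) = A * U * (A * {d} * H) :=
        congrArg Subtype.val hcd
      rw [hproj, hproj, ← hAU] at hcd
      have hmem : d ∈ DoubleCoset.doubleCoset c ((A ⊔ U : Subgroup G) : Set G) H :=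
        hcd.superset (DoubleCoset.mem_doubleCoset_self (A ⊔ U) H d)
      exact Subtype.ext (DoubleCoset.doubleCoset_eq_of_mem
        (mem_doubleCoset_of_mem_doubleCoset_sup hA hC hrigid hc hd hmem)).symm
    · rintro ⟨_, _, ⟨u, hu, c, hc, rfl⟩, rfl⟩
      refine ⟨⟨_, c, hc, rfl⟩, Subtype.ext ?_⟩
      change (A : Set G) * U * (A * {c} * H) = A * U * {u * c} * H
      rw [hproj, ← Set.singleton_mul_singleton, ← mul_assoc, mul_assoc (A : Set G) U {u},
        Subgroup.subgroup_mul_singleton hu]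
  exact ⟨Equiv.ofBijective f hf, fun c _ => hproj c⟩
end

section
/- Let G be a group, let A, U, H be subgroups of G, and let V be a subgroup of G contained in U ∩ H. If U ∩ (A·H) ⊆ A·V, then (A·U) ∩ H = (A ∩ H)·V, as subsets of G. -/
open scoped Pointwise

/-- Let `A`, `U`, `H` be subgroups of `G` and `V` a subgroup contained in `U ⊓ H`.
If `U ∩ (A·H) ⊆ A·V`, then `(A·U) ∩ H = (A ∩ H)·V` as subsets of `G`. -/
theorem inter_mul_of_inter_subset
    {G : Type*} [Group G] (A U H V : Subgroup G)
    (hV : V ≤ U ⊓ H)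
    (h : (U : Set G) ∩ ((A : Set G) * (H : Set G)) ⊆ (A : Set G) * (V : Set G)) :
    ((A : Set G) * (U : Set G)) ∩ (H : Set G) =
      ((A : Set G) ∩ (H : Set G)) * (V : Set G) := by
  apply Set.Subset.antisymm
  · rintro _ ⟨⟨a, ha, u, hu, rfl⟩, hx⟩
    obtain ⟨b, hb, v, hv, rfl⟩ := h ⟨hu, a⁻¹, A.inv_mem ha, a * u, hx, inv_mul_cancel_left a u⟩
    refine ⟨a * b, ⟨A.mul_mem ha hb, ?_⟩, v, hv, mul_assoc a b v⟩
    have hxv : a * b * v ∈ H := by simpa [mul_assoc] using hx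
    exact (H.mul_mem_cancel_right (hV hv).2).1 hxv
  · rintro _ ⟨a, ⟨ha, haH⟩, v, hv, rfl⟩
    exact ⟨⟨a, ha, v, (hV hv).1, rfl⟩, H.mul_mem haH (hV hv).2⟩
end
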